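/- arXiv:2308.16104 — 9 statements merged into one kernel-verified Lean document; each statement's English description precedes it below -/
import Mathlib

section
/- Let N ≥ 2, let x : {1,...,N} → {0,1}, let F = {i ∈ {1,...,N} : x(i) = 1}, and let Z ∈ ℕ with Z ≥ 1. Then blocks(F) ≤ Z if and only if there exists z : {1,...,N−1} → {0,1} such that x(i) − x(i+1) ≤ z(i) and x(i+1) − x(i) ≤ z(i) for all i ∈ {1,...,N−1}, and x(1) + Σ_{i=1}^{N−1} z(i) + x(N) ≤ 2Z. -/
/-- Number of blocks (maximal runs of consecutive integers) of a finite set of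
positive integers: each block is counted at its smallest element. -/
def blocks (F : Finset ℕ) : ℕ := (F.filter (fun i => i - 1 ∉ F)).card

theorem blocks_filter_Icc (N : ℕ) (x : ℕ → ℕ) :
    blocks ((Finset.Icc 1 N).filter (fun i => x i = 1)) =
      ∑ i ∈ Finset.Icc 1 N, if x i = 1 ∧ (i = 1 ∨ x (i - 1) ≠ 1) then 1 else 0 := by
  rw [blocks, Finset.filter_filter, ← Finset.card_filter]
  congr 1
  refine Finset.filter_congr fun i hi => ?_
  simp only [Finset.mem_filter, Finset.mem_Icc] at hi ⊢
  grind

/-- Twice the number of blocks is the total variation of the indicator extended by zero. -/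
theorem two_mul_blocks_filter_Icc (n : ℕ) (x : ℕ → ℕ)
    (hx : ∀ i ∈ Finset.Icc 1 (n + 1), x i ≤ 1) :
    2 * blocks ((Finset.Icc 1 (n + 1)).filter (fun i => x i = 1)) =
      x 1 + (∑ i ∈ Finset.Icc 1 n, Nat.dist (x i) (x (i + 1))) + x (n + 1) := by
  rw [blocks_filter_Icc]
  induction n with
  | zero =>
    have h := hx 1 (by simp)
    rw [zero_add, Finset.Icc_self, Finset.sum_singleton]
    interval_cases h1 : x 1 <;> simp
  | succ n ih =>
    have ih' := ih fun i hi => hx i (by simp only [Finset.mem_Icc] at hi ⊢; omega)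
    have ha := hx (n + 1) (by simp)
    have hb := hx (n + 1 + 1) (by simp)
    rw [Finset.sum_Icc_succ_top (by omega : 1 ≤ n + 1 + 1), mul_add, ih',
      Finset.sum_Icc_succ_top (by omega : 1 ≤ n + 1)]
    simp only [Nat.dist, Nat.add_sub_cancel]
    split_ifs <;> omega

theorem stmt_2 (N : ℕ) (hN : 2 ≤ N) (x : ℕ → ℕ) (hx : ∀ i ∈ Finset.Icc 1 N, x i ≤ 1)
    (Z : ℕ) (hZ : 1 ≤ Z) :
    blocks ((Finset.Icc 1 N).filter (fun i => x i = 1)) ≤ Z ↔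
      ∃ z : ℕ → ℕ, (∀ i ∈ Finset.Icc 1 (N - 1), z i ≤ 1) ∧
        (∀ i ∈ Finset.Icc 1 (N - 1),
          (x i : ℤ) - (x (i + 1) : ℤ) ≤ (z i : ℤ) ∧
          (x (i + 1) : ℤ) - (x i : ℤ) ≤ (z i : ℤ)) ∧
        x 1 + (∑ i ∈ Finset.Icc 1 (N - 1), z i) + x N ≤ 2 * Z := by
  obtain ⟨n, rfl⟩ : ∃ n, N = n + 1 := ⟨N - 1, by omega⟩
  have key := two_mul_blocks_filter_Icc n x hx
  rw [Nat.add_sub_cancel]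
  constructor
  · intro h
    refine ⟨fun i => Nat.dist (x i) (x (i + 1)), fun i hi => ?_, fun i _ => ?_,
      key ▸ Nat.mul_le_mul_left 2 h⟩
    · rw [Finset.mem_Icc] at hi
      have ha := hx i (by rw [Finset.mem_Icc]; omega)
      have hb := hx (i + 1) (by rw [Finset.mem_Icc]; omega)
      simp only [Nat.dist]
      omega
    · simp only [Nat.dist]
      omega
  · rintro ⟨z, -, hz, hsum⟩
    have hle : ∑ i ∈ Finset.Icc 1 n, Nat.dist (x i) (x (i + 1)) ≤ ∑ i ∈ Finset.Icc 1 n, z i := by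
      refine Finset.sum_le_sum fun i hi => ?_
      have := hz i hi
      simp only [Nat.dist]
      omega
    omega
end

section
/- Let n ≥ 1 and E = {1,...,n−1}, and define φ(F) = Σ_{i∈F} 2^{i−1} for F ⊆ E. Consider the bi-objective problem whose feasible solutions are pairs (F,v) with F ⊆ E, v ∈ ℝ≥0 and φ(F) ≤ v, with objective value (φ(F), v), where the first coordinate is maximized and the second is minimized. Then the set of non-dominated points of this problem is exactly {(k,k) : k ∈ {0,1,...,2^{n−1}−1}}, and hence has cardinality 2^{n−1} (exponential in n). -/
/-- `q'` dominates `q` when the first objective is maximized and the second minimized. -/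
def Dominates (q' q : ℝ × ℝ) : Prop :=
  q.1 ≤ q'.1 ∧ q'.2 ≤ q.2 ∧ (q.1 < q'.1 ∨ q'.2 < q.2)

theorem sum_Icc_two_pow_pred_add_one (m : ℕ) :
    ∑ i ∈ Finset.Icc 1 m, 2 ^ (i - 1) + 1 = 2 ^ m := by
  induction m with
  | zero => simp
  | succ m ih =>
    rw [Finset.sum_Icc_succ_top (by omega), Nat.add_sub_cancel, pow_succ]
    omega

theorem sum_two_pow_pred_lt {m : ℕ} {F : Finset ℕ} (hF : F ⊆ Finset.Icc 1 m) :
    ∑ i ∈ F, 2 ^ (i - 1) < 2 ^ m := by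
  have h : ∑ i ∈ F, 2 ^ (i - 1) ≤ ∑ i ∈ Finset.Icc 1 m, 2 ^ (i - 1) :=
    Finset.sum_le_sum_of_subset hF
  have := sum_Icc_two_pow_pred_add_one m
  omega

theorem exists_subset_Icc_sum_two_pow_pred_eq (m : ℕ) :
    ∀ k < 2 ^ m, ∃ F ⊆ Finset.Icc 1 m, ∑ i ∈ F, 2 ^ (i - 1) = k := by
  induction m with
  | zero =>
    intro k hk
    exact ⟨∅, by simp, by simp at hk; simp [hk]⟩
  | succ m ih =>
    intro k hk
    have hsub : Finset.Icc 1 m ⊆ Finset.Icc 1 (m + 1) :=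
      Finset.Icc_subset_Icc_right (Nat.le_succ m)
    rcases lt_or_ge k (2 ^ m) with h | h
    · obtain ⟨F, hF, hs⟩ := ih k h
      exact ⟨F, hF.trans hsub, hs⟩
    · obtain ⟨F, hF, hs⟩ := ih (k - 2 ^ m) (by rw [pow_succ] at hk; omega)
      have hnot : m + 1 ∉ F := fun hm => by
        have := Finset.mem_Icc.mp (hF hm)
        omega
      refine ⟨insert (m + 1) F, Finset.insert_subset (by simp) (hF.trans hsub), ?_⟩
      rw [Finset.sum_insert hnot, hs, Nat.add_sub_cancel]
      omega

theorem stmt_3 (n : ℕ) (hn : 1 ≤ n)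
    (φ : Finset ℕ → ℕ) (hφ : ∀ F, φ F = ∑ i ∈ F, 2 ^ (i - 1))
    (P : Set (ℝ × ℝ))
    (hP : P = {q | ∃ (F : Finset ℕ) (v : ℝ), F ⊆ Finset.Icc 1 (n - 1) ∧ 0 ≤ v ∧
      (φ F : ℝ) ≤ v ∧ q = ((φ F : ℝ), v)}) :
    {q ∈ P | ¬ ∃ q' ∈ P, Dominates q' q} =
      {q : ℝ × ℝ | ∃ k : ℕ, k < 2 ^ (n - 1) ∧ q = ((k : ℝ), (k : ℝ))} ∧
    {q ∈ P | ¬ ∃ q' ∈ P, Dominates q' q}.ncard = 2 ^ (n - 1) := by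
  have hset : {q ∈ P | ¬ ∃ q' ∈ P, Dominates q' q} =
      {q : ℝ × ℝ | ∃ k : ℕ, k < 2 ^ (n - 1) ∧ q = ((k : ℝ), (k : ℝ))} := by
    subst hP
    ext q
    constructor
    · rintro ⟨⟨F, v, hF, -, hFv, rfl⟩, hnd⟩
      refine ⟨φ F, hφ F ▸ sum_two_pow_pred_lt hF, ?_⟩
      rcases hFv.eq_or_lt with h | h
      · rw [← h]
      · exact (hnd ⟨(φ F, φ F), ⟨F, φ F, hF, Nat.cast_nonneg _, le_rfl, rfl⟩,
          le_rfl, hFv, Or.inr h⟩).elim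
    · rintro ⟨k, hk, rfl⟩
      obtain ⟨F, hF, hs⟩ := exists_subset_Icc_sum_two_pow_pred_eq (n - 1) k hk
      rw [← hφ] at hs
      refine ⟨⟨F, k, hF, Nat.cast_nonneg _, by rw [hs], by rw [hs]⟩, ?_⟩
      rintro ⟨_, ⟨G, v, -, -, hGv, rfl⟩, h₁, h₂, h₃⟩
      dsimp only at h₁ h₂ h₃
      rcases h₃ with h | h <;> linarith
  refine ⟨hset, ?_⟩
  have himage : {q : ℝ × ℝ | ∃ k : ℕ, k < 2 ^ (n - 1) ∧ q = ((k : ℝ), (k : ℝ))} =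
      (fun k : ℕ => ((k : ℝ), (k : ℝ))) '' (Finset.range (2 ^ (n - 1)) : Set ℕ) := by
    ext q
    simp [eq_comm]
  rw [hset, himage, Set.ncard_image_of_injective _ fun a b h => by simpa using h,
    Set.ncard_coe_finset, Finset.card_range]
end

section
/- Let M be a finite nonempty set, let E be a finite set partitioned into pairwise disjoint sets {E_m}_{m∈M} with ∪_{m∈M} E_m = E, let c : E → ℕ satisfy c(e) ≥ 1 for all e, let b : M → ℝ satisfy b(m) > 0 for all m and Σ_{m∈M} b(m) = 1, and let p : (subsets of E) → ℝ be arbitrary. Set V = max_{m∈M} (1/b(m)) · Σ_{e∈E_m} c(e). Consider the bi-objective problem whose feasible solutions are pairs (F,v) with F ⊆ E, v ∈ ℝ≥0 and Σ_{e∈F∩E_m} c(e) ≤ b(m)·v for all m ∈ M, with objective value (p(F), v), where p is maximized and v is minimized. Then the set of non-dominated points of this problem has cardinality at most 1 + Σ_{m∈M} ⌊b(m)·V⌋. -/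
theorem stmt_4 {M E : Type*} [Fintype M] [Nonempty M] [Fintype E] [DecidableEq E]
    (Em : M → Finset E) (hdisj : ∀ m m', m ≠ m' → Disjoint (Em m) (Em m'))
    (hcover : ∀ e : E, ∃ m, e ∈ Em m)
    (c : E → ℕ) (hc : ∀ e, 1 ≤ c e)
    (b : M → ℝ) (hb : ∀ m, 0 < b m) (hbsum : ∑ m, b m = 1)
    (p : Finset E → ℝ)
    (V : ℝ) (hV : V = Finset.univ.sup' Finset.univ_nonempty
      (fun m => (1 / b m) * ∑ e ∈ Em m, (c e : ℝ)))
    (Feas : Finset E → ℝ → Prop)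
    (hFeas : ∀ F v, Feas F v ↔ 0 ≤ v ∧ ∀ m, (∑ e ∈ F ∩ Em m, (c e : ℝ)) ≤ b m * v)
    (P : Set (ℝ × ℝ)) (hP : P = {q | ∃ F v, Feas F v ∧ q = (p F, v)})
    (ND : Set (ℝ × ℝ)) (hND : ND = {q ∈ P | ¬ ∃ q' ∈ P, Dominates q' q}) :
    ND.Finite ∧ (ND.ncard : ℤ) ≤ 1 + ∑ m, ⌊b m * V⌋ := by
  classical
  have hfeasible_sup : ∀ F, Feas F (Finset.univ.sup' Finset.univ_nonempty
      fun m => (∑ e ∈ F ∩ Em m, (c e : ℝ)) / b m) := by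
    intro F
    have hle := fun m => Finset.le_sup' (fun m => (∑ e ∈ F ∩ Em m, (c e : ℝ)) / b m)
      (Finset.mem_univ m)
    refine (hFeas _ _).2 ⟨?_, fun m => ?_⟩
    · obtain ⟨m⟩ := ‹Nonempty M›
      exact (div_nonneg (by positivity) (hb m).le).trans (hle m)
    · rw [mul_comm]
      exact (div_le_iff₀ (hb m)).1 (hle m)
  have hfull : ∀ m, (∑ e ∈ Em m, (c e : ℝ)) ≤ b m * V := by
    intro m
    have h := Finset.le_sup' (fun m => (1 / b m) * ∑ e ∈ Em m, (c e : ℝ)) (Finset.mem_univ m)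
    rw [← hV] at h
    rw [one_div_mul_eq_div, div_le_iff₀ (hb m)] at h
    linarith
  have hV_mul : ∀ m, 0 ≤ b m * V := fun m =>
    (Finset.sum_nonneg fun _ _ => Nat.cast_nonneg _).trans (hfull m)
  let T : Finset ℝ := insert 0 (Finset.univ.biUnion fun m =>
    (Finset.Icc 1 ⌊b m * V⌋₊).image fun k : ℕ => (k : ℝ) / b m)
  have hmaps : Set.MapsTo Prod.snd ND (T : Set ℝ) := by
    intro q hq
    rw [hND, hP] at hq
    obtain ⟨⟨F, v, hF, rfl⟩, hnd⟩ := hq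
    obtain ⟨m, -, hm⟩ := Finset.exists_mem_eq_sup' Finset.univ_nonempty
      fun m => (∑ e ∈ F ∩ Em m, (c e : ℝ)) / b m
    have hsup := hfeasible_sup F
    rw [hm] at hsup
    have hv : v = (∑ e ∈ F ∩ Em m, (c e : ℝ)) / b m := by
      refine le_antisymm (not_lt.1 fun hlt => hnd ⟨_, ⟨F, _, hsup, rfl⟩, le_rfl, hlt.le,
        Or.inr hlt⟩) ?_
      rw [div_le_iff₀ (hb m), mul_comm]
      exact ((hFeas _ _).1 hF).2 m
    have hbound : (∑ e ∈ F ∩ Em m, (c e : ℝ)) ≤ b m * V :=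
      (Finset.sum_le_sum_of_subset_of_nonneg Finset.inter_subset_right
        fun _ _ _ => Nat.cast_nonneg _).trans (hfull m)
    rw [← Nat.cast_sum] at hv hbound
    simp only [T, Finset.coe_insert, Set.mem_insert_iff, Finset.mem_coe, Finset.mem_biUnion,
      Finset.mem_univ, true_and, Finset.mem_image, Finset.mem_Icc]
    rcases Nat.eq_zero_or_pos (∑ e ∈ F ∩ Em m, c e) with h0 | hpos
    · left
      rw [hv, h0, Nat.cast_zero, zero_div]
    · exact Or.inr ⟨m, _, ⟨hpos, Nat.le_floor hbound⟩, hv.symm⟩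
  have hinj : Set.InjOn Prod.snd ND := by
    rintro ⟨x, v⟩ hq ⟨y, w⟩ hr (rfl : v = w)
    rw [hND] at hq hr
    rcases lt_trichotomy x y with h | h | h
    · exact absurd ⟨_, hr.1, h.le, le_rfl, Or.inl h⟩ hq.2
    · rw [h]
    · exact absurd ⟨_, hq.1, h.le, le_rfl, Or.inl h⟩ hr.2
  have hcard : T.card ≤ 1 + ∑ m, ⌊b m * V⌋₊ := by
    refine (Finset.card_insert_le _ _).trans ?_
    rw [add_comm]
    gcongr
    refine Finset.card_biUnion_le.trans (Finset.sum_le_sum fun m _ => ?_)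
    exact Finset.card_image_le.trans (by simp)
  refine ⟨Set.Finite.of_injOn hmaps hinj T.finite_toSet, ?_⟩
  have hncard : ND.ncard ≤ T.card := by
    rw [← Set.ncard_coe_finset]
    exact Set.ncard_le_ncard_of_injOn _ hmaps hinj T.finite_toSet
  calc (ND.ncard : ℤ) ≤ ((1 + ∑ m, ⌊b m * V⌋₊ : ℕ) : ℤ) := by exact_mod_cast hncard.trans hcard
    _ = 1 + ∑ m, ⌊b m * V⌋ := by
      push_cast
      exact congrArg _ (Finset.sum_congr rfl fun m _ => Int.natCast_floor_eq_floor (hV_mul m))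
end

section
/- Let N ≥ 1, E = {1,...,N}, and let ũ : E → ℝ satisfy ũ(e) > 0 for all e. Suppose there exists ī ∈ {1,...,N} such that ũ(j) ≤ ũ(j') whenever j ≤ j' ≤ ī and ũ(j) ≥ ũ(j') whenever ī ≤ j ≤ j' (ũ is unimodal). Consider the bi-objective problem whose feasible solutions are pairs (F,v) with F ⊆ E, v ∈ ℝ≥0 and |F| ≤ v, with objective value (Σ_{e∈F} ũ(e), v), where the first coordinate is maximized and the second is minimized. Then for every non-dominated point (P,v) of this problem there exists an efficient solution (F,v) with Σ_{e∈F} ũ(e) = P such that F is a set of consecutive integers (i.e., F has at most one block). -/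
/-- If every element of `F` outside `I` has weight at most that of every element of `I`, all
weights are nonnegative and `F` has at most as many elements as `I`, then the total weight of `F`
is at most that of `I`. -/
theorem sum_le_sum_of_card_le_of_forall_le {ι : Type*} [DecidableEq ι] {u : ι → ℝ}
    {F I : Finset ι} (hcard : F.card ≤ I.card) (hF : ∀ e ∈ F \ I, 0 ≤ u e)
    (hI : ∀ i ∈ I, 0 ≤ u i) (hle : ∀ i ∈ I, ∀ e ∈ F \ I, u e ≤ u i) :
    ∑ e ∈ F, u e ≤ ∑ e ∈ I, u e := by
  have hsdiff : (F \ I).card ≤ (I \ F).card := by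
    have h1 := Finset.card_sdiff_add_card_inter F I
    have h2 := Finset.card_sdiff_add_card_inter I F
    rw [Finset.inter_comm I F] at h2
    omega
  have key : ∑ e ∈ F \ I, u e ≤ ∑ e ∈ I \ F, u e := by
    rcases (F \ I).eq_empty_or_nonempty with h | h
    · rw [h, Finset.sum_empty]
      exact Finset.sum_nonneg fun i hi => hI i (Finset.mem_sdiff.1 hi).1
    · obtain ⟨m, hm, hmax⟩ := Finset.exists_max_image (F \ I) u h
      calc ∑ e ∈ F \ I, u e ≤ (F \ I).card • u m := Finset.sum_le_card_nsmul _ _ _ hmax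
        _ ≤ (I \ F).card • u m := nsmul_le_nsmul_left (hF m hm) hsdiff
        _ ≤ ∑ e ∈ I \ F, u e := Finset.card_nsmul_le_sum _ _ _
            fun i hi => hle i (Finset.mem_sdiff.1 hi).1 m hm
  have h1 := Finset.sum_inter_add_sum_sdiff F I u
  have h2 := Finset.sum_inter_add_sum_sdiff I F u
  rw [Finset.inter_comm I F] at h2
  linarith

/-- A unimodal weight on `{1, …, N}` admits, for each size `k + 1 ≤ N`, an interval of that size
around the peak whose elements all weigh at least as much as every element outside it. -/
theorem exists_Icc_forall_le_of_unimodal {N : ℕ} {u : ℕ → ℝ} {m : ℕ} (hm : m ∈ Finset.Icc 1 N)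
    (hmono1 : ∀ j j', 1 ≤ j → j ≤ j' → j' ≤ m → u j ≤ u j')
    (hmono2 : ∀ j j', m ≤ j → j ≤ j' → j' ≤ N → u j' ≤ u j) (k : ℕ) (hk : k + 1 ≤ N) :
    ∃ a b : ℕ, 1 ≤ a ∧ a ≤ m ∧ m ≤ b ∧ b ≤ N ∧ b = a + k ∧
      ∀ i e, a ≤ i → i ≤ b → 1 ≤ e → e ≤ N → (e < a ∨ b < e) → u e ≤ u i := by
  rw [Finset.mem_Icc] at hm
  induction k with
  | zero =>
    refine ⟨m, m, hm.1, le_rfl, le_rfl, hm.2, rfl, fun i e hi hi' he heN h => ?_⟩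
    obtain rfl : i = m := le_antisymm hi' hi
    rcases h with h | h
    · exact hmono1 e i he h.le le_rfl
    · exact hmono2 i e le_rfl h.le heN
  | succ k ih =>
    obtain ⟨a, b, ha, ham, hmb, hbN, hab, H⟩ := ih (by omega)
    by_cases hleft : 1 < a ∧ (b = N ∨ u (b + 1) ≤ u (a - 1))
    · obtain ⟨ha1, hb⟩ := hleft
      refine ⟨a - 1, b, by omega, by omega, hmb, hbN, by omega,
        fun i e hi hi' he heN h => ?_⟩
      rcases hi.eq_or_lt with rfl | hlt
      · rcases h with h | h
        · exact hmono1 _ _ he h.le (by omega)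
        · rcases hb with hb | hb
          · omega
          · exact (hmono2 (b + 1) e (by omega) h heN).trans hb
      · exact H i e (by omega) hi' he heN (by omega)
    · have hbN' : b < N := by
        by_contra hb
        exact hleft ⟨by omega, Or.inl (by omega)⟩
      refine ⟨a, b + 1, ha, ham, by omega, hbN', by omega, fun i e hi hi' he heN h => ?_⟩
      rcases hi'.eq_or_lt with rfl | hlt
      · rcases h with h | h
        · have hab' : u (a - 1) ≤ u (b + 1) := by
            by_contra hc
            exact hleft ⟨by omega, Or.inr (not_le.1 hc).le⟩
          exact (hmono1 e (a - 1) he (by omega) (by omega)).trans hab'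
        · exact hmono2 _ _ (by omega) h.le heN
      · exact H i e hi (by omega) he heN (by omega)

/-- Every subset of `{1, …, N}` is matched in size, and at least matched in total weight, by an
interval, when the weight is positive and unimodal. -/
theorem exists_Icc_card_eq_sum_le_of_unimodal {N : ℕ} {u : ℕ → ℝ}
    (hu : ∀ e ∈ Finset.Icc 1 N, 0 < u e) {m : ℕ} (hm : m ∈ Finset.Icc 1 N)
    (hmono1 : ∀ j j', 1 ≤ j → j ≤ j' → j' ≤ m → u j ≤ u j')
    (hmono2 : ∀ j j', m ≤ j → j ≤ j' → j' ≤ N → u j' ≤ u j)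
    {F : Finset ℕ} (hF : F ⊆ Finset.Icc 1 N) :
    ∃ a b : ℕ, Finset.Icc a b ⊆ Finset.Icc 1 N ∧ (Finset.Icc a b).card = F.card ∧
      ∑ e ∈ F, u e ≤ ∑ e ∈ Finset.Icc a b, u e := by
  rcases F.eq_empty_or_nonempty with rfl | hne
  · exact ⟨1, 0, by simp, by simp, by simp⟩
  have hpos := hne.card_pos
  have hcard := Finset.card_le_card hF
  rw [Nat.card_Icc] at hcard
  obtain ⟨a, b, ha, -, -, hbN, hab, H⟩ :=
    exists_Icc_forall_le_of_unimodal hm hmono1 hmono2 (F.card - 1) (by omega)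
  have hsub : Finset.Icc a b ⊆ Finset.Icc 1 N := Finset.Icc_subset_Icc ha hbN
  have hc : (Finset.Icc a b).card = F.card := by
    rw [Nat.card_Icc]
    omega
  refine ⟨a, b, hsub, hc, sum_le_sum_of_card_le_of_forall_le hc.ge
    (fun e he => (hu e (hF (Finset.mem_sdiff.1 he).1)).le) (fun i hi => (hu i (hsub hi)).le)
    fun i hi e he => ?_⟩
  obtain ⟨heF, heI⟩ := Finset.mem_sdiff.1 he
  have heN := Finset.mem_Icc.1 (hF heF)
  rw [Finset.mem_Icc] at hi heI
  exact H i e hi.1 hi.2 heN.1 heN.2 (by omega)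


theorem stmt_7 (N : ℕ) (hN : 1 ≤ N) (u : ℕ → ℝ)
    (hu : ∀ e ∈ Finset.Icc 1 N, 0 < u e)
    (ibar : ℕ) (hibar : ibar ∈ Finset.Icc 1 N)
    (hmono1 : ∀ j j', 1 ≤ j → j ≤ j' → j' ≤ ibar → u j ≤ u j')
    (hmono2 : ∀ j j', ibar ≤ j → j ≤ j' → j' ≤ N → u j' ≤ u j)
    (Feas : Finset ℕ → ℝ → Prop)
    (hFeas : ∀ F v, Feas F v ↔ F ⊆ Finset.Icc 1 N ∧ 0 ≤ v ∧ (F.card : ℝ) ≤ v)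
    (P : Set (ℝ × ℝ)) (hP : P = {q | ∃ F v, Feas F v ∧ q = (∑ e ∈ F, u e, v)}) :
    ∀ q : ℝ × ℝ, q ∈ P → (¬ ∃ q' ∈ P, Dominates q' q) →
      ∃ F : Finset ℕ, Feas F q.2 ∧ (∑ e ∈ F, u e) = q.1 ∧
        (¬ ∃ F' v', Feas F' v' ∧
          Dominates (∑ e ∈ F', u e, v') (∑ e ∈ F, u e, q.2)) ∧
        ∃ a b : ℕ, F = Finset.Icc a b := by
  subst hP
  rintro _ ⟨F₀, v, hF₀, rfl⟩ hnd
  obtain ⟨hsub₀, hv, hcard₀⟩ := (hFeas F₀ v).1 hF₀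
  obtain ⟨a, b, hsub, hcard, hle⟩ :=
    exists_Icc_card_eq_sum_le_of_unimodal hu hibar hmono1 hmono2 hsub₀
  have hI : Feas (Finset.Icc a b) v := (hFeas _ _).2 ⟨hsub, hv, by rwa [hcard]⟩
  have hsum : ∑ e ∈ Finset.Icc a b, u e = ∑ e ∈ F₀, u e := by
    refine (hle.eq_or_lt.resolve_right fun hlt => hnd ?_).symm
    exact ⟨_, ⟨_, _, hI, rfl⟩, hle, le_rfl, Or.inl hlt⟩
  refine ⟨Finset.Icc a b, hI, hsum, ?_, a, b, rfl⟩
  rintro ⟨F', v', hF', hdom⟩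
  rw [hsum] at hdom
  exact hnd ⟨_, ⟨F', v', hF', rfl⟩, hdom⟩
end

section
/- Let N ≥ 1, E = {1,...,N}, and let c : E → ℕ satisfy c(e) ≥ 1 for all e. Suppose there exists ī ∈ {1,...,N} such that c(j) ≥ c(j') whenever j ≤ j' ≤ ī and c(j) ≤ c(j') whenever ī ≤ j ≤ j'. Consider the bi-objective problem whose feasible solutions are pairs (F,v) with F ⊆ E, v ∈ ℝ≥0 and Σ_{e∈F} c(e) ≤ v, with objective value (|F|, v), where the first coordinate is maximized and the second is minimized. Then for every non-dominated point (P,v) of this problem there exists an efficient solution (F,v) with |F| = P such that F is a set of consecutive integers (i.e., F has at most one block). -/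
theorem Finset.sum_le_sum_of_card_eq_of_threshold {α : Type*} [DecidableEq α] {s t : Finset α}
    {c : α → ℕ} (k : ℕ) (hcard : s.card = t.card) (hs : ∀ x ∈ s \ t, c x ≤ k)
    (ht : ∀ x ∈ t \ s, k ≤ c x) : ∑ x ∈ s, c x ≤ ∑ x ∈ t, c x := by
  have h1 := Finset.sum_le_card_nsmul _ _ _ hs
  have h2 := Finset.card_nsmul_le_sum _ _ _ ht
  rw [← Finset.card_sdiff_eq_card_sdiff_iff.mpr hcard] at h2
  rw [← Finset.sum_inter_add_sum_sdiff s t, ← Finset.sum_inter_add_sum_sdiff t s,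
    Finset.inter_comm t s]
  exact Nat.add_le_add_left (h1.trans h2) _

/-- For costs decreasing up to `m` and increasing afterwards, every set of segments can be replaced
by an interval of the same cardinality that is at most as expensive. -/
theorem exists_Icc_card_eq_sum_le {N m : ℕ} {c : ℕ → ℕ} (hm : m ≤ N)
    (hanti : ∀ j j', 1 ≤ j → j ≤ j' → j' ≤ m → c j' ≤ c j)
    (hmono : ∀ j j', m ≤ j → j ≤ j' → j' ≤ N → c j ≤ c j')
    {F : Finset ℕ} (hF : F ⊆ Finset.Icc 1 N) :
    ∃ a b : ℕ, Finset.Icc a b ⊆ Finset.Icc 1 N ∧ (Finset.Icc a b).card = F.card ∧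
      ∑ e ∈ Finset.Icc a b, c e ≤ ∑ e ∈ F, c e := by
  set L := F.filter (· ≤ m) with hL
  set R := F.filter (¬ · ≤ m) with hR
  have hLsub : L ⊆ Finset.Icc 1 m := fun x hx => by
    have := Finset.mem_filter.mp hx
    exact Finset.mem_Icc.mpr ⟨(Finset.mem_Icc.mp (hF this.1)).1, this.2⟩
  have hRsub : R ⊆ Finset.Ioc m N := fun x hx => by
    have := Finset.mem_filter.mp hx
    exact Finset.mem_Ioc.mpr ⟨not_le.mp this.2, (Finset.mem_Icc.mp (hF this.1)).2⟩
  have hl : L.card ≤ m := by simpa using Finset.card_le_card hLsub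
  have hr : R.card ≤ N - m := by simpa using Finset.card_le_card hRsub
  have hcard : L.card + R.card = F.card := Finset.card_filter_add_card_filter_not _
  have hsum : ∑ e ∈ L, c e + ∑ e ∈ R, c e = ∑ e ∈ F, c e :=
    Finset.sum_filter_add_sum_filter_not _ _ _
  have hsumL : ∑ e ∈ Finset.Icc (m + 1 - L.card) m, c e ≤ ∑ e ∈ L, c e := by
    refine Finset.sum_le_sum_of_card_eq_of_threshold (c (m + 1 - L.card)) ?_ ?_ ?_
    · rw [Nat.card_Icc]; omega
    · intro x hx
      simp only [Finset.mem_sdiff, Finset.mem_Icc] at hx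
      exact hanti _ _ (by omega) hx.1.1 hx.1.2
    · intro x hx
      obtain ⟨hxL, hxI⟩ := Finset.mem_sdiff.mp hx
      have hpos := Finset.card_pos.mpr ⟨x, hxL⟩
      have hxm := Finset.mem_Icc.mp (hLsub hxL)
      rw [Finset.mem_Icc] at hxI
      exact hanti _ _ hxm.1 (by omega) (by omega)
  have hsumR : ∑ e ∈ Finset.Ioc m (m + R.card), c e ≤ ∑ e ∈ R, c e := by
    refine Finset.sum_le_sum_of_card_eq_of_threshold (c (m + R.card)) ?_ ?_ ?_
    · simp
    · intro x hx
      simp only [Finset.mem_sdiff, Finset.mem_Ioc] at hx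
      exact hmono _ _ (by omega) hx.1.2 (by omega)
    · intro x hx
      obtain ⟨hxR, hxI⟩ := Finset.mem_sdiff.mp hx
      have hxm := Finset.mem_Ioc.mp (hRsub hxR)
      rw [Finset.mem_Ioc] at hxI
      exact hmono _ _ (by omega) (by omega) hxm.2
  refine ⟨m + 1 - L.card, m + R.card, Finset.Icc_subset_Icc (by omega) (by omega), ?_, ?_⟩
  · rw [Nat.card_Icc]; omega
  · have hunion : Finset.Icc (m + 1 - L.card) (m + R.card) =
        Finset.Icc (m + 1 - L.card) m ∪ Finset.Ioc m (m + R.card) := by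
      ext x
      simp only [Finset.mem_union, Finset.mem_Icc, Finset.mem_Ioc]
      omega
    have hdisj : Disjoint (Finset.Icc (m + 1 - L.card) m) (Finset.Ioc m (m + R.card)) :=
      Finset.disjoint_left.mpr fun x hx hx' =>
        absurd (Finset.mem_Icc.mp hx).2 (not_le.mpr (Finset.mem_Ioc.mp hx').1)
    rw [hunion, Finset.sum_union hdisj, ← hsum]
    exact Nat.add_le_add hsumL hsumR

theorem stmt_9 (N : ℕ) (hN : 1 ≤ N) (c : ℕ → ℕ)
    (hc : ∀ e ∈ Finset.Icc 1 N, 1 ≤ c e)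
    (ibar : ℕ) (hibar : ibar ∈ Finset.Icc 1 N)
    (hmono1 : ∀ j j', 1 ≤ j → j ≤ j' → j' ≤ ibar → c j' ≤ c j)
    (hmono2 : ∀ j j', ibar ≤ j → j ≤ j' → j' ≤ N → c j ≤ c j')
    (Feas : Finset ℕ → ℝ → Prop)
    (hFeas : ∀ F v, Feas F v ↔ F ⊆ Finset.Icc 1 N ∧ 0 ≤ v ∧ (∑ e ∈ F, (c e : ℝ)) ≤ v)
    (P : Set (ℝ × ℝ)) (hP : P = {q | ∃ F v, Feas F v ∧ q = ((F.card : ℝ), v)}) :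
    ∀ q : ℝ × ℝ, q ∈ P → (¬ ∃ q' ∈ P, Dominates q' q) →
      ∃ F : Finset ℕ, Feas F q.2 ∧ (F.card : ℝ) = q.1 ∧
        (¬ ∃ F' v', Feas F' v' ∧
          Dominates ((F'.card : ℝ), v') ((F.card : ℝ), q.2)) ∧
        ∃ a b : ℕ, F = Finset.Icc a b := by
  subst hP
  rintro _ ⟨F, v, hFv, rfl⟩ hnd
  obtain ⟨hFsub, hv, hcost⟩ := (hFeas F v).mp hFv
  obtain ⟨a, b, hsub, hcard, hsum⟩ :=
    exists_Icc_card_eq_sum_le (Finset.mem_Icc.mp hibar).2 hmono1 hmono2 hFsub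
  have hsum' : ∑ e ∈ Finset.Icc a b, (c e : ℝ) ≤ ∑ e ∈ F, (c e : ℝ) := by exact_mod_cast hsum
  refine ⟨Finset.Icc a b, (hFeas _ _).mpr ⟨hsub, hv, hsum'.trans hcost⟩, by rw [hcard], ?_,
    a, b, rfl⟩
  rintro ⟨F', v', hF', hdom⟩
  rw [hcard] at hdom
  exact hnd ⟨_, ⟨F', v', hF', rfl⟩, hdom⟩
end

section
/- Let N ≥ 1 and E = {1,...,N}, let ũ : E → ℝ satisfy ũ(e) ≥ 0 for all e, let M be a finite nonempty set, let {E_m}_{m∈M} be pairwise disjoint sets of consecutive integers with ∪_{m∈M} E_m = E, let c : E → ℕ satisfy c(e) ≥ 1 for all e, let b : M → ℝ satisfy b(m) > 0 for all m, and let v ∈ ℝ≥0. Call F ⊆ E feasible if Σ_{e∈F∩E_m} c(e) ≤ b(m)·v for all m ∈ M. Let f = max{ Σ_{e∈F} ũ(e) : F feasible }, attained by a feasible set F* with K = blocks(F*), and for k ≥ 1 let f_k = max{ Σ_{e∈F} ũ(e) : F feasible and blocks(F) ≤ k }. Then f ≥ f_k for all k ≥ 1; if k ≥ K then f_k = f;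 and if 1 ≤ k < K then K · f_k ≥ k · f. -/
/-- A `k`-element subset of largest weight has at least the average weight. -/
theorem exists_subset_card_eq_mul_sum_le {α : Type*} [DecidableEq α] (w : α → ℝ) {k : ℕ}
    (hk : 1 ≤ k) (T : Finset α) (hT : k ≤ T.card) :
    ∃ S ⊆ T, S.card = k ∧ (k : ℝ) * ∑ s ∈ T, w s ≤ (T.card : ℝ) * ∑ s ∈ S, w s := by
  induction T using Finset.strongInduction with
  | H T ih =>
    rcases hT.eq_or_lt with h | h
    · exact ⟨T, Finset.Subset.refl T, h.symm, by rw [h]⟩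
    · obtain ⟨a, ha, hmin⟩ := T.exists_min_image w (Finset.card_pos.mp (by omega))
      have hcard : (T.erase a).card + 1 = T.card := Finset.card_erase_add_one ha
      obtain ⟨S, hS, hSk, hle⟩ := ih _ (Finset.erase_ssubset ha) (by omega)
      refine ⟨S, hS.trans (Finset.erase_subset a T), hSk, ?_⟩
      have hsum := Finset.add_sum_erase T w ha
      have hmin' : ((T.erase a).card : ℝ) * w a ≤ ∑ s ∈ T.erase a, w s := by
        simpa using Finset.card_nsmul_le_sum (T.erase a) w (w a)
          fun x hx => hmin x (Finset.mem_of_mem_erase hx)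
      rw [← hsum, ← hcard]
      push_cast
      have hn : (1 : ℝ) ≤ (T.erase a).card := by exact_mod_cast (by omega)
      have hk0 : (0 : ℝ) ≤ k := Nat.cast_nonneg k
      generalize ((T.erase a).card : ℝ) = n at *
      generalize ∑ s ∈ T.erase a, w s = x at *
      refine le_of_mul_le_mul_left ?_ (show (0 : ℝ) < n by linarith)
      have h₁ := mul_le_mul_of_nonneg_left hmin' hk0
      have h₂ := mul_le_mul_of_nonneg_left hle (show (0 : ℝ) ≤ n + 1 by linarith)
      linarith

/-- The smallest elements of the blocks of `F`. -/
def blockStarts (F : Finset ℕ) : Finset ℕ := F.filter (fun i => i - 1 ∉ F)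

/-- The last block start of `F` that is at most `i`. -/
def blockLabel (F : Finset ℕ) (i : ℕ) : ℕ := ((blockStarts F).filter (· ≤ i)).sup id

theorem blockLabel_of_mem_blockStarts {F : Finset ℕ} {i : ℕ} (hi : i ∈ blockStarts F) :
    blockLabel F i = i := by
  apply le_antisymm
  · exact Finset.sup_le fun j hj => (Finset.mem_filter.mp hj).2
  · exact Finset.le_sup (f := id) (Finset.mem_filter.mpr ⟨hi, le_rfl⟩)

theorem blockLabel_pred {F : Finset ℕ} {i : ℕ} (hi : i ∉ blockStarts F) :
    blockLabel F (i - 1) = blockLabel F i := by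
  unfold blockLabel
  congr 1
  refine Finset.filter_congr fun j hj => ?_
  have : j ≠ i := fun h => hi (h ▸ hj)
  omega

theorem blockLabel_mem_blockStarts {F : Finset ℕ} (h0 : 0 ∉ F) {i : ℕ} (hi : i ∈ F) :
    blockLabel F i ∈ blockStarts F := by
  induction i with
  | zero => exact absurd hi h0
  | succ i ih =>
    by_cases h : i + 1 ∈ blockStarts F
    · rwa [blockLabel_of_mem_blockStarts h]
    · rw [← blockLabel_pred h]
      refine ih (by_contra fun h' => h ?_)
      exact Finset.mem_filter.mpr ⟨hi, h'⟩

/-- A union of blocks of `F` has at most as many blocks as were selected. -/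
theorem blocks_filter_blockLabel_le (F S : Finset ℕ) :
    blocks (F.filter (blockLabel F · ∈ S)) ≤ S.card := by
  refine Finset.card_le_card fun i hi => ?_
  obtain ⟨hiF, hpred⟩ := Finset.mem_filter.mp hi
  obtain ⟨hiF, hiS⟩ := Finset.mem_filter.mp hiF
  by_cases h : i ∈ blockStarts F
  · rwa [blockLabel_of_mem_blockStarts h] at hiS
  · refine absurd (Finset.mem_filter.mpr ⟨?_, (blockLabel_pred h).symm ▸ hiS⟩) hpred
    exact by_contra fun h' => h (Finset.mem_filter.mpr ⟨hiF, h'⟩)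

/-- Keeping the `k` heaviest blocks of `F` retains a fraction `k / blocks F` of its weight. -/
theorem exists_subset_blocks_le_mul_sum_le (u : ℕ → ℝ) {F : Finset ℕ} (h0 : 0 ∉ F) {k : ℕ}
    (hk : 1 ≤ k) (hkF : k ≤ blocks F) :
    ∃ G ⊆ F, blocks G ≤ k ∧ (k : ℝ) * ∑ e ∈ F, u e ≤ (blocks F : ℝ) * ∑ e ∈ G, u e := by
  obtain ⟨S, -, hSk, hle⟩ := exists_subset_card_eq_mul_sum_le
    (fun s => ∑ e ∈ F with blockLabel F e = s, u e) hk (blockStarts F) hkF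
  refine ⟨F.filter (blockLabel F · ∈ S), Finset.filter_subset _ F,
    (blocks_filter_blockLabel_le F S).trans hSk.le, ?_⟩
  rw [Finset.sum_fiberwise_of_maps_to fun e he => blockLabel_mem_blockStarts h0 he,
    Finset.sum_fiberwise_eq_sum_filter] at hle
  exact hle

theorem stmt_12 {M : Type*} [Fintype M] [Nonempty M]
    (N : ℕ) (hN : 1 ≤ N)
    (u : ℕ → ℝ) (hu : ∀ e ∈ Finset.Icc 1 N, 0 ≤ u e)
    (Em : M → Finset ℕ)
    (hconsec : ∀ m, ∃ a b, Em m = Finset.Icc a b)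
    (hdisj : ∀ m m', m ≠ m' → Disjoint (Em m) (Em m'))
    (hcover : Finset.univ.biUnion Em = Finset.Icc 1 N)
    (c : ℕ → ℕ) (hc : ∀ e ∈ Finset.Icc 1 N, 1 ≤ c e)
    (b : M → ℝ) (hb : ∀ m, 0 < b m)
    (v : ℝ) (hv : 0 ≤ v)
    (Feas : Finset ℕ → Prop)
    (hFeas : ∀ F, Feas F ↔ F ⊆ Finset.Icc 1 N ∧
      ∀ m, (∑ e ∈ F ∩ Em m, (c e : ℝ)) ≤ b m * v)
    (f : ℝ) (Fstar : Finset ℕ) (hFstar : Feas Fstar)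
    (hfval : (∑ e ∈ Fstar, u e) = f)
    (hfopt : ∀ F, Feas F → (∑ e ∈ F, u e) ≤ f)
    (K : ℕ) (hK : K = blocks Fstar)
    (fk : ℕ → ℝ)
    (hfk : ∀ k, 1 ≤ k →
      (∃ F, Feas F ∧ blocks F ≤ k ∧ (∑ e ∈ F, u e) = fk k) ∧
      (∀ F, Feas F → blocks F ≤ k → (∑ e ∈ F, u e) ≤ fk k)) :
    (∀ k, 1 ≤ k → fk k ≤ f) ∧
    (∀ k, 1 ≤ k → K ≤ k → fk k = f) ∧
    (∀ k, 1 ≤ k → k < K → (k : ℝ) * f ≤ (K : ℝ) * fk k) := by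
  have hle : ∀ k, 1 ≤ k → fk k ≤ f := fun k hk => by
    obtain ⟨⟨F, hF, -, hval⟩, -⟩ := hfk k hk
    exact hval ▸ hfopt F hF
  refine ⟨hle, fun k hk hKk => (hle k hk).antisymm ?_, fun k hk hkK => ?_⟩
  · exact hfval ▸ (hfk k hk).2 Fstar hFstar (hK ▸ hKk)
  · obtain ⟨hsub, hbudget⟩ := (hFeas Fstar).mp hFstar
    have h0 : 0 ∉ Fstar := fun h => by simpa using hsub h
    obtain ⟨G, hG, hGk, hGsum⟩ :=
      exists_subset_blocks_le_mul_sum_le u h0 hk (hK ▸ hkK.le)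
    have hGfeas : Feas G := (hFeas G).mpr ⟨hG.trans hsub, fun m =>
      (Finset.sum_le_sum_of_subset_of_nonneg (Finset.inter_subset_inter_right hG)
        fun _ _ _ => Nat.cast_nonneg _).trans (hbudget m)⟩
    rw [hfval, ← hK] at hGsum
    exact hGsum.trans
      (mul_le_mul_of_nonneg_left ((hfk k hk).2 G hGfeas hGk) (Nat.cast_nonneg K))
end

section
/- Let M be a finite nonempty set, let E be a finite set partitioned into pairwise disjoint sets {E_m}_{m∈M} with ∪_{m∈M} E_m = E, let c : E → ℕ satisfy c(e) ≥ 1 for all e, and let b : M → ℝ satisfy b(m) > 0 for all m. Let F ⊆ E, set v̄ = max_{m∈M} (1/b(m)) · Σ_{e∈F∩E_m} c(e), let M̄ = { m ∈ M : Σ_{e∈F∩E_m} c(e) = b(m)·v̄ } (which is nonempty), and define δ = min( min_{m∈M̄} 1/b(m), min_{m∈M∖M̄} (b(m)·v̄ − ⌈b(m)·v̄ − 1⌉)/b(m) ), where the second inner minimum is omitted if M∖M̄ is empty. Then δ > 0, and every set F' ⊆ E with max_{m∈M} (1/b(m)) · Σ_{e∈F'∩E_m} c(e) < v̄ satisfies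 Σ_{e∈F'∩E_m} c(e) ≤ b(m)·(v̄ − δ) for all m ∈ M. -/
theorem Int.cast_ceil_sub_one_lt {R : Type*} [Ring R] [LinearOrder R] [IsStrictOrderedRing R]
    [FloorRing R] (x : R) : (⌈x - 1⌉ : R) < x := by
  simpa using Int.ceil_lt_add_one (x - 1)

theorem Nat.cast_le_ceil_sub_one_of_lt {R : Type*} [Ring R] [LinearOrder R]
    [IsStrictOrderedRing R] [FloorRing R] {n : ℕ} {x : R} (h : (n : R) < x) :
    (n : R) ≤ (⌈x - 1⌉ : R) := by
  have h' : (n : ℤ) < ⌈x⌉ := Int.lt_ceil.2 (by exact_mod_cast h)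
  rw [Int.ceil_sub_one]
  exact_mod_cast Int.le_sub_one_of_lt h'

theorem stmt_15 {M E : Type*} [Fintype M] [Nonempty M] [Fintype E] [DecidableEq E]
    (Em : M → Finset E) (hdisj : ∀ m m', m ≠ m' → Disjoint (Em m) (Em m'))
    (hcover : ∀ e : E, ∃ m, e ∈ Em m)
    (c : E → ℕ) (hc : ∀ e, 1 ≤ c e)
    (b : M → ℝ) (hb : ∀ m, 0 < b m)
    (F : Finset E)
    (vbar : ℝ) (hvbar : vbar = Finset.univ.sup' Finset.univ_nonempty
      (fun m => (1 / b m) * ∑ e ∈ F ∩ Em m, (c e : ℝ)))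
    (Mbar : Set M)
    (hMbar : Mbar = {m | (∑ e ∈ F ∩ Em m, (c e : ℝ)) = b m * vbar})
    (δ : ℝ)
    (hδ : δ = sInf ({x | ∃ m ∈ Mbar, x = 1 / b m} ∪
      {x | ∃ m ∉ Mbar, x = (b m * vbar - (⌈b m * vbar - 1⌉ : ℤ)) / b m})) :
    Mbar.Nonempty ∧ 0 < δ ∧
    ∀ F' : Finset E,
      (Finset.univ.sup' Finset.univ_nonempty
        (fun m => (1 / b m) * ∑ e ∈ F' ∩ Em m, (c e : ℝ))) < vbar →
      ∀ m, (∑ e ∈ F' ∩ Em m, (c e : ℝ)) ≤ b m * (vbar - δ) := by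
  set gap : M → ℝ := fun m => (b m * vbar - (⌈b m * vbar - 1⌉ : ℤ)) / b m with hgap
  have gap_of_mem : ∀ m ∈ Mbar, gap m = 1 / b m := by
    intro m hm
    rw [hMbar, Set.mem_ofPred_eq, ← Nat.cast_sum] at hm
    simp only [hgap, ← hm, Int.ceil_sub_one, Int.ceil_natCast]
    push_cast
    ring
  have steps_eq : {x | ∃ m ∈ Mbar, x = 1 / b m} ∪
      {x | ∃ m ∉ Mbar, x = (b m * vbar - (⌈b m * vbar - 1⌉ : ℤ)) / b m} = Set.range gap := by
    ext x
    constructor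
    · rintro (⟨m, hm, rfl⟩ | ⟨m, -, rfl⟩)
      exacts [⟨m, gap_of_mem m hm⟩, ⟨m, rfl⟩]
    · rintro ⟨m, rfl⟩
      by_cases hm : m ∈ Mbar
      exacts [Or.inl ⟨m, hm, gap_of_mem m hm⟩, Or.inr ⟨m, hm, rfl⟩]
  rw [steps_eq] at hδ
  refine ⟨?_, ?_, fun F' hF' m => ?_⟩
  · obtain ⟨m, -, hm⟩ := Finset.exists_mem_eq_sup' Finset.univ_nonempty
      (fun m => (1 / b m) * ∑ e ∈ F ∩ Em m, (c e : ℝ))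
    refine ⟨m, ?_⟩
    have := (hb m).ne'
    rw [hMbar, Set.mem_ofPred_eq, hvbar, hm]
    field_simp
  · obtain ⟨m, hm⟩ := (Set.range_nonempty gap).csInf_mem (Set.finite_range gap)
    rw [hδ, ← hm]
    exact div_pos (sub_pos.2 (Int.cast_ceil_sub_one_lt _)) (hb m)
  · have hle : δ ≤ gap m := hδ ▸ csInf_le (Set.finite_range gap).bddBelow ⟨m, rfl⟩
    have hlt := (Finset.sup'_lt_iff Finset.univ_nonempty).1 hF' m (Finset.mem_univ m)
    rw [one_div, inv_mul_lt_iff₀ (hb m), ← Nat.cast_sum] at hlt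
    have hsum := Nat.cast_le_ceil_sub_one_of_lt hlt
    rw [hgap, le_div_iff₀ (hb m)] at hle
    rw [← Nat.cast_sum]
    linarith
end

section
/- Let N ≥ 1 and k ≥ 1. The map that sends a set F ⊆ {1,...,N} to the set of pairs { (min B, max B) : B a block of F } ⊆ {1,...,N} × {1,...,N} is injective on subsets of {1,...,N}; moreover, if blocks(F) ≤ k then the image set has cardinality at most k. Consequently, the number of sets F ⊆ {1,...,N} with blocks(F) ≤ k is at most Σ_{j=0}^{k} binomial(N², j). -/
/-- The set of pairs `(min B, max B)` over the blocks `B` of `F`: `(a, b)` is such a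
pair iff `a ≤ b`, all of `{a, ..., b}` lies in `F`, and neither `a - 1` nor `b + 1`
lies in `F`. -/
def blockPairs (F : Finset ℕ) : Finset (ℕ × ℕ) :=
  (F ×ˢ F).filter
    (fun q => q.1 ≤ q.2 ∧ Finset.Icc q.1 q.2 ⊆ F ∧ q.1 - 1 ∉ F ∧ q.2 + 1 ∉ F)

theorem mem_blockPairs {F : Finset ℕ} {a b : ℕ} :
    (a, b) ∈ blockPairs F ↔
      a ≤ b ∧ Finset.Icc a b ⊆ F ∧ a - 1 ∉ F ∧ b + 1 ∉ F := by
  simp only [blockPairs, Finset.mem_filter, Finset.mem_product, and_iff_right_iff_imp]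
  rintro ⟨hab, hF, -, -⟩
  exact ⟨hF (Finset.left_mem_Icc.2 hab), hF (Finset.right_mem_Icc.2 hab)⟩

theorem exists_block_start {F : Finset ℕ} (h0 : 0 ∉ F) {x : ℕ} (hx : x ∈ F) :
    ∃ a ≤ x, Finset.Icc a x ⊆ F ∧ a - 1 ∉ F := by
  induction x with
  | zero => exact absurd hx h0
  | succ n ih =>
    by_cases hn : n ∈ F
    · obtain ⟨a, han, hF, ha⟩ := ih hn
      refine ⟨a, by omega, fun y hy => ?_, ha⟩
      rw [Finset.mem_Icc] at hy
      rcases Nat.lt_or_ge n y with h | h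
      · rwa [show y = n + 1 by omega]
      · exact hF (Finset.mem_Icc.2 ⟨hy.1, h⟩)
    · exact ⟨n + 1, le_rfl, by simpa using hx, by simpa using hn⟩

theorem exists_block_end {F : Finset ℕ} {x : ℕ} (hx : x ∈ F) :
    ∃ b, x ≤ b ∧ Finset.Icc x b ⊆ F ∧ b + 1 ∉ F := by
  have hex : ∃ b, x ≤ b ∧ b + 1 ∉ F := by
    refine ⟨F.sup id, Finset.le_sup (f := id) hx, fun h => ?_⟩
    exact absurd (Finset.le_sup (f := id) h) (Nat.not_succ_le_self _)
  obtain ⟨hxb, hb⟩ := Nat.find_spec hex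
  refine ⟨Nat.find hex, hxb, fun y hy => ?_, hb⟩
  rw [Finset.mem_Icc] at hy
  rcases hy.1.eq_or_lt with rfl | hlt
  · exact hx
  · by_contra hy'
    refine Nat.find_min hex (m := y - 1) (by omega) ⟨by omega, ?_⟩
    rwa [Nat.sub_add_cancel (by omega)]

theorem mem_iff_exists_mem_blockPairs {F : Finset ℕ} (h0 : 0 ∉ F) {x : ℕ} :
    x ∈ F ↔ ∃ q ∈ blockPairs F, x ∈ Finset.Icc q.1 q.2 := by
  constructor
  · intro hx
    obtain ⟨a, hax, haF, ha⟩ := exists_block_start h0 hx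
    obtain ⟨b, hxb, hbF, hb⟩ := exists_block_end hx
    refine ⟨(a, b), mem_blockPairs.2 ⟨hax.trans hxb, fun y hy => ?_, ha, hb⟩,
      Finset.mem_Icc.2 ⟨hax, hxb⟩⟩
    rw [Finset.mem_Icc] at hy
    rcases le_total y x with h | h
    · exact haF (Finset.mem_Icc.2 ⟨hy.1, h⟩)
    · exact hbF (Finset.mem_Icc.2 ⟨h, hy.2⟩)
  · rintro ⟨⟨a, b⟩, hq, hx⟩
    exact (mem_blockPairs.1 hq).2.1 hx

theorem blockPairs_injOn : Set.InjOn blockPairs {F | 0 ∉ F} := by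
  intro F hF G hG h
  ext x
  rw [mem_iff_exists_mem_blockPairs hF, mem_iff_exists_mem_blockPairs hG, h]

theorem card_blockPairs_le_blocks (F : Finset ℕ) : (blockPairs F).card ≤ blocks F := by
  refine Finset.card_le_card_of_injOn Prod.fst ?_ ?_
  · rintro ⟨a, b⟩ hq
    obtain ⟨hab, hF, ha, -⟩ := mem_blockPairs.1 hq
    exact Finset.mem_filter.2 ⟨hF (Finset.left_mem_Icc.2 hab), ha⟩
  · rintro ⟨a, b⟩ hq ⟨a', b'⟩ hq' rfl
    obtain ⟨hab, hF, -, hb⟩ := mem_blockPairs.1 hq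
    obtain ⟨hab', hF', -, hb'⟩ := mem_blockPairs.1 hq'
    rcases lt_trichotomy b b' with h | h | h
    · exact absurd (hF' (Finset.mem_Icc.2 ⟨by dsimp only; omega, h⟩)) hb
    · exact Prod.ext rfl h
    · exact absurd (hF (Finset.mem_Icc.2 ⟨by dsimp only at *; omega, h⟩)) hb'

theorem blockPairs_subset_product {F S : Finset ℕ} (h : F ⊆ S) : blockPairs F ⊆ S ×ˢ S :=
  (Finset.filter_subset _ _).trans (Finset.product_subset_product h h)

theorem card_powerset_filter_card_le {α : Type*} (S : Finset α) (k : ℕ) :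
    (S.powerset.filter (fun T => T.card ≤ k)).card ≤
      ∑ j ∈ Finset.range (k + 1), S.card.choose j := by
  classical
  calc (S.powerset.filter (fun T => T.card ≤ k)).card
      ≤ ((Finset.range (k + 1)).biUnion fun j => S.powersetCard j).card := by
        refine Finset.card_le_card fun T hT => ?_
        rw [Finset.mem_filter, Finset.mem_powerset] at hT
        exact Finset.mem_biUnion.2 ⟨T.card, Finset.mem_range.2 (Nat.lt_succ_of_le hT.2),
          Finset.mem_powersetCard.2 ⟨hT.1, rfl⟩⟩
    _ ≤ ∑ j ∈ Finset.range (k + 1), (S.powersetCard j).card := Finset.card_biUnion_le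
    _ = ∑ j ∈ Finset.range (k + 1), S.card.choose j := by simp only [Finset.card_powersetCard]

theorem stmt_17 (N k : ℕ) (hN : 1 ≤ N) (hk : 1 ≤ k) :
    (∀ F G : Finset ℕ, F ⊆ Finset.Icc 1 N → G ⊆ Finset.Icc 1 N →
      blockPairs F = blockPairs G → F = G) ∧
    (∀ F : Finset ℕ, F ⊆ Finset.Icc 1 N → blocks F ≤ k → (blockPairs F).card ≤ k) ∧
    ((Finset.Icc 1 N).powerset.filter (fun F => blocks F ≤ k)).card ≤
      ∑ j ∈ Finset.range (k + 1), Nat.choose (N ^ 2) j := by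
  have h0 : ∀ F : Finset ℕ, F ⊆ Finset.Icc 1 N → 0 ∉ F := fun F hF h => by
    simpa using hF h
  refine ⟨fun F G hF hG h => blockPairs_injOn (h0 F hF) (h0 G hG) h,
    fun F _ hk => (card_blockPairs_le_blocks F).trans hk, ?_⟩
  have hcard : (Finset.Icc 1 N ×ˢ Finset.Icc 1 N).card = N ^ 2 := by
    simp [sq]
  rw [← hcard]
  refine le_trans (Finset.card_le_card_of_injOn blockPairs ?_ ?_)
    (card_powerset_filter_card_le _ k)
  · intro F hF
    obtain ⟨hFN, hFk⟩ := Finset.mem_filter.1 hF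
    exact Finset.mem_filter.2
      ⟨Finset.mem_powerset.2 (blockPairs_subset_product (Finset.mem_powerset.1 hFN)),
        (card_blockPairs_le_blocks F).trans hFk⟩
  · exact blockPairs_injOn.mono fun F hF =>
      h0 F (Finset.mem_powerset.1 (Finset.mem_filter.1 hF).1)
end

section
/- Let E = {1,...,N} with its natural linear order, and let M and D be finite index sets. Let A₁ be an M × E matrix and A₂ a D × E matrix, both with entries in {0,1} (viewed over ℚ), such that every row of A₁ and every row of A₂ has the consecutive ones property: for each row i, if the (i,j) entry and the (i,j') entry both equal 1 with j < j', then the (i,l) entry equals 1 for all j ≤ l ≤ j'. Then the block matrix with rows indexed by M ⊕ D and columns indexed by E ⊕ D, given by [[A₁, 0], [−A₂, I_D]] (where I_D is the D × D identity matrix and 0 is the M × D zero matrix), is totally unimodular, i.e., every square submatrix has determinant in {−1, 0, 1}. -/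
/-- A matrix whose rows are differences of indicators of initial segments has determinant
`-1`, `0` or `1`. -/
lemma det_indicator_sub_indicator_mem (k : ℕ) (g a b : Fin k → ℕ) :
    (Matrix.of fun i j => (if g j < b i then (1 : ℚ) else 0) - if g j < a i then 1 else 0).det
      ∈ ({-1, 0, 1} : Set ℚ) := by
  induction k with
  | zero => simp
  | succ k ih =>
    set P : Matrix (Fin (k + 1)) (Fin (k + 1)) ℚ :=
      Matrix.of fun i j => (if g j < b i then (1 : ℚ) else 0) - if g j < a i then 1 else 0
    have hPa : ∀ i j, P i j = (if g j < b i then (1 : ℚ) else 0) - if g j < a i then 1 else 0 :=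
      fun _ _ => rfl
    obtain ⟨j₀, hj₀⟩ := Finite.exists_min g
    by_cases h0 : ∀ i, P i j₀ = 0
    · simp [Matrix.det_eq_zero_of_column_eq_zero j₀ h0]
    push Not at h0
    obtain ⟨i₀, hi₀⟩ := h0
    have hpiv : P i₀ j₀ = 1 ∨ P i₀ j₀ = -1 := by
      rw [hPa] at hi₀ ⊢
      split_ifs at hi₀ ⊢ <;> simp_all
    have hsq : P i₀ j₀ * P i₀ j₀ = 1 := by rcases hpiv with h | h <;> rw [h] <;> norm_num
    obtain ⟨e, he⟩ : ∃ e : ℕ, ∀ j, P i₀ j₀ * P i₀ j = if g j < e then 1 else 0 := by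
      by_cases hb : g j₀ < b i₀ <;> by_cases ha : g j₀ < a i₀
      · simp [hPa, hb, ha] at hi₀
      · refine ⟨b i₀, fun j => ?_⟩
        have : ¬ g j < a i₀ := fun h => ha ((hj₀ j).trans_lt h)
        simp [hPa, hb, ha, this]
      · refine ⟨a i₀, fun j => ?_⟩
        have : ¬ g j < b i₀ := fun h => hb ((hj₀ j).trans_lt h)
        simp only [hPa, hb, ha, this, if_true, if_false]
        split_ifs <;> norm_num
      · simp [hPa, hb, ha] at hi₀
    have hrow : ∀ i, ∃ a' b' : ℕ, ∀ j, P i j - P i j₀ * (P i₀ j₀ * P i₀ j) =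
        (if g j < b' then (1 : ℚ) else 0) - if g j < a' then 1 else 0 := by
      intro i
      by_cases hb : g j₀ < b i <;> by_cases ha : g j₀ < a i
      · exact ⟨a i, b i, fun j => by simp [hPa i, hb, ha]⟩
      · refine ⟨e, b i, fun j => ?_⟩
        have : ¬ g j < a i := fun h => ha ((hj₀ j).trans_lt h)
        simp [he, hPa i, hb, ha, this]
      · refine ⟨a i, e, fun j => ?_⟩
        have : ¬ g j < b i := fun h => hb ((hj₀ j).trans_lt h)
        simp only [he, hPa i, hb, ha, this, if_true, if_false]
        ring
      · exact ⟨a i, b i, fun j => by simp [hPa i, hb, ha]⟩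
    choose a' b' hab using hrow
    let Q : Matrix (Fin (k + 1)) (Fin (k + 1)) ℚ := Matrix.of fun i j =>
      if i = i₀ then P i j else P i j - P i j₀ * (P i₀ j₀ * P i₀ j)
    have hPQ : P.det = Q.det := by
      refine Matrix.det_eq_of_forall_row_eq_smul_add_const
        (fun i => if i = i₀ then 0 else P i j₀ * P i₀ j₀) i₀ (by simp) ?_
      intro i j
      by_cases hi : i = i₀
      · simp [Q, hi]
      · simp [Q, hi]
        ring
    rw [hPQ, Matrix.det_succ_column Q j₀, Finset.sum_eq_single i₀]
    · have hminor : Q.submatrix i₀.succAbove j₀.succAbove = Matrix.of fun i j =>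
          (if g (j₀.succAbove j) < b' (i₀.succAbove i) then (1 : ℚ) else 0) -
            if g (j₀.succAbove j) < a' (i₀.succAbove i) then 1 else 0 := by
        ext i j
        simp [Q, Fin.succAbove_ne, hab]
      have hQ : Q i₀ j₀ = P i₀ j₀ := by simp [Q]
      have := ih (g ∘ j₀.succAbove) (a' ∘ i₀.succAbove) (b' ∘ i₀.succAbove)
      simp only [Function.comp_apply, ← hminor] at this
      rw [hQ]
      simp only [Set.mem_insert_iff, Set.mem_singleton_iff] at this ⊢
      rcases this with h | h | h <;> rcases hpiv with h' | h' <;>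
        rcases neg_one_pow_eq_or ℚ ((i₀ : ℕ) + j₀) with h'' | h'' <;> rw [h, h', h''] <;> norm_num
    · intro i _ hi
      have : Q i j₀ = 0 := by simp [Q, hi, hsq]
      simp [this]
    · simp

/-- A `0`-`1` row with the consecutive ones property is a difference of indicators of initial
segments. -/
lemma exists_eq_indicator_sub_indicator {N : ℕ} (v : Fin N → ℚ) (h01 : ∀ j, v j = 0 ∨ v j = 1)
    (hc : ∀ j j' l : Fin N, j ≤ l → l ≤ j' → v j = 1 → v j' = 1 → v l = 1) :
    ∃ a b : ℕ, ∀ j : Fin N,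
      v j = (if (j : ℕ) < b then (1 : ℚ) else 0) - if (j : ℕ) < a then 1 else 0 := by
  by_cases h : ∃ j, v j = 1
  · have hne : (Finset.univ.filter fun j => v j = 1).Nonempty := by
      obtain ⟨j, hj⟩ := h
      exact ⟨j, by simpa using hj⟩
    obtain ⟨p, hp, hpmin⟩ := Finset.exists_min_image _ id hne
    obtain ⟨q, hq, hqmax⟩ := Finset.exists_max_image _ id hne
    simp only [Finset.mem_filter, Finset.mem_univ, true_and, id] at hp hpmin hq hqmax
    refine ⟨p, q + 1, fun j => ?_⟩
    have hpq : (p : ℕ) ≤ q := hpmin q hq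
    rcases h01 j with hj | hj
    · have : ¬ ((p : ℕ) ≤ j ∧ (j : ℕ) ≤ q) := fun ⟨h₁, h₂⟩ => by
        have := hc p q j h₁ h₂ hp hq
        rw [hj] at this
        norm_num at this
      rw [hj]
      split_ifs <;> first | omega | norm_num
    · have h₁ : (p : ℕ) ≤ j := hpmin j hj
      have h₂ : (j : ℕ) ≤ q := hqmax j hj
      rw [hj, if_pos (by omega), if_neg (by omega)]
      norm_num
  · push Not at h
    exact ⟨0, 0, fun j => by simpa using (h01 j).resolve_right (h j)⟩

theorem stmt_18 {M D : Type*} [Fintype M] [Fintype D] [DecidableEq D]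
    (N : ℕ) (A1 : Matrix M (Fin N) ℚ) (A2 : Matrix D (Fin N) ℚ)
    (h01 : ∀ i j, A1 i j = 0 ∨ A1 i j = 1)
    (h02 : ∀ i j, A2 i j = 0 ∨ A2 i j = 1)
    (hc1 : ∀ (i : M) (j j' l : Fin N), j ≤ l → l ≤ j' →
      A1 i j = 1 → A1 i j' = 1 → A1 i l = 1)
    (hc2 : ∀ (i : D) (j j' l : Fin N), j ≤ l → l ≤ j' →
      A2 i j = 1 → A2 i j' = 1 → A2 i l = 1) :
    ∀ (k : ℕ) (f : Fin k → M ⊕ D) (g : Fin k → Fin N ⊕ D),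
      Function.Injective f → Function.Injective g →
      ((Matrix.fromBlocks A1 0 (-A2) 1).submatrix f g).det ∈ ({-1, 0, 1} : Set ℚ) := by
  classical
  have hrow : ∀ i : M ⊕ D, ∃ a b : ℕ, ∀ j : Fin N, Matrix.fromRows A1 (-A2) i j =
      (if (j : ℕ) < b then (1 : ℚ) else 0) - if (j : ℕ) < a then 1 else 0 := by
    rintro (i | i)
    · exact exists_eq_indicator_sub_indicator (A1 i) (h01 i) (hc1 i)
    · obtain ⟨a, b, h⟩ := exists_eq_indicator_sub_indicator (A2 i) (h02 i) (hc2 i)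
      exact ⟨b, a, fun j => by simp [h j]⟩
  choose a b hab using hrow
  have hX : (Matrix.fromRows A1 (-A2)).IsTotallyUnimodular := by
    intro k f g _ _
    have hsub : (Matrix.fromRows A1 (-A2)).submatrix f g = Matrix.of fun i j =>
        (if (g j : ℕ) < b (f i) then (1 : ℚ) else 0) - if (g j : ℕ) < a (f i) then 1 else 0 := by
      ext i j
      exact hab (f i) (g j)
    rw [hsub]
    have := det_indicator_sub_indicator_mem k (fun j => g j) (a ∘ f) (b ∘ f)
    simp only [Set.mem_insert_iff, Set.mem_singleton_iff] at this
    rcases this with h | h | h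
    · exact ⟨-1, by simpa using h.symm⟩
    · exact ⟨0, by simpa using h.symm⟩
    · exact ⟨1, by simpa using h.symm⟩
  have hTU : (Matrix.fromBlocks A1 0 (-A2) (1 : Matrix D D ℚ)).IsTotallyUnimodular := by
    have hcols := ((Matrix.fromCols_one_isTotallyUnimodular_iff _).2 hX).submatrix id
      (Sum.map id Sum.inr : Fin N ⊕ D → Fin N ⊕ (M ⊕ D))
    convert hcols using 1
    ext (i | i) (j | j) <;> simp [Matrix.one_apply]
  intro k f g hf hg
  obtain ⟨s, hs⟩ := hTU k f g hf hg
  rw [← hs]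
  cases s <;> simp
end
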